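/- The approximation relation ⇒_apr terminates: there is no infinite sequence of clause sets N_0 ⇒_apr N_1 ⇒_apr N_2 ⇒_apr ⋯ . -/

import Mathlib

namespace FOApprox

/-- First-order terms over a countable signature of function symbols. -/
inductive Tm : Type where
  | var : ℕ → Tm
  | fn : ℕ → List Tm → Tm

/-- Atoms: a predicate symbol applied to a list of terms. -/
structure Atom : Type where
  pred : ℕ
  args : List Tm

/-- Substitutions map variables to terms. -/
abbrev Subst := ℕ → Tm

mutual
/-- Application of a substitution to a term. -/
def Tm.subst (σ : Subst) : Tm → Tm
  | .var x => σ x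
  | .fn f ts => .fn f (Tm.substList σ ts)
def Tm.substList (σ : Subst) : List Tm → List Tm
  | [] => []
  | t :: ts => Tm.subst σ t :: Tm.substList σ ts
end

def Atom.subst (σ : Subst) (A : Atom) : Atom := ⟨A.pred, Tm.substList σ A.args⟩

/-- A clause Γ → Δ: `neg` is the multiset Γ of negative atoms,
`pos` the multiset Δ of positive atoms. -/
structure Clause : Type where
  neg : Multiset Atom
  pos : Multiset Atom

def Clause.subst (σ : Subst) (C : Clause) : Clause :=
  ⟨C.neg.map (Atom.subst σ), C.pos.map (Atom.subst σ)⟩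

/-- A term is ground if it is invariant under all substitutions. -/
def Tm.Ground (t : Tm) : Prop := ∀ σ : Subst, t.subst σ = t

def Clause.Ground (C : Clause) : Prop := ∀ σ : Subst, C.subst σ = C

/-- A grounding substitution maps every variable to a ground term. -/
def Subst.Grounding (σ : Subst) : Prop := ∀ x, (σ x).Ground

/-- A Herbrand interpretation `I` (a set of ground atoms) satisfies a clause
Γ → Δ if for every grounding substitution σ, Δσ ∩ I ≠ ∅ or Γσ ⊄ I. -/
def SatClause (I : Set Atom) (C : Clause) : Prop :=
  ∀ σ : Subst, σ.Grounding →
    (∃ A ∈ C.pos, A.subst σ ∈ I) ∨ (∃ A ∈ C.neg, A.subst σ ∉ I)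

def Models (I : Set Atom) (N : Set Clause) : Prop := ∀ C ∈ N, SatClause I C

def Satisfiable (N : Set Clause) : Prop := ∃ I : Set Atom, Models I N

/-- Apply a substitution to all clauses of a set (variables are shared). -/
def SubstSet (σ : Subst) (N : Set Clause) : Set Clause := Clause.subst σ '' N

/-- A finite clause set is a conflicting core if all its simultaneous ground
instances are unsatisfiable. -/
def ConflictingCore (Nb : Set Clause) : Prop :=
  Nb.Finite ∧ ∀ τ : Subst, τ.Grounding → ¬ Satisfiable (SubstSet τ Nb)

/-- `Nb` is a conflicting core of `N`: additionally every clause of `Nb`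
is an instance of a clause of `N`. -/
def ConflictingCoreOf (Nb N : Set Clause) : Prop :=
  ConflictingCore Nb ∧ ∀ C ∈ Nb, ∃ C' ∈ N, ∃ σ : Subst, C = Clause.subst σ C'

/-- An atom occurs (positively or negatively) in a clause. -/
def AtomIn (A : Atom) (C : Clause) : Prop := A ∈ C.neg ∨ A ∈ C.pos

mutual
def Tm.fns : Tm → List ℕ
  | .var _ => []
  | .fn f ts => f :: Tm.fnsList ts
def Tm.fnsList : List Tm → List ℕ
  | [] => []
  | t :: ts => Tm.fns t ++ Tm.fnsList ts
end

mutual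
def Tm.vars : Tm → List ℕ
  | .var x => [x]
  | .fn _ ts => Tm.varsList ts
def Tm.varsList : List Tm → List ℕ
  | [] => []
  | t :: ts => Tm.vars t ++ Tm.varsList ts
end

def VarInClause (x : ℕ) (C : Clause) : Prop :=
  ∃ A, AtomIn A C ∧ ∃ t ∈ A.args, x ∈ Tm.vars t

def FnInClause (f : ℕ) (C : Clause) : Prop :=
  ∃ A, AtomIn A C ∧ ∃ t ∈ A.args, f ∈ Tm.fns t

def PredInClause (P : ℕ) (C : Clause) : Prop := ∃ A, AtomIn A C ∧ A.pred = P

def PredIn (P : ℕ) (N : Set Clause) : Prop := ∃ C ∈ N, PredInClause P C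

def PredNotIn (P : ℕ) (N : Set Clause) : Prop := ∀ C ∈ N, ¬ PredInClause P C

def FnNotIn (f : ℕ) (N : Set Clause) : Prop := ∀ C ∈ N, ¬ FnInClause f C

def VarNotInClause (x : ℕ) (C : Clause) : Prop := ¬ VarInClause x C

/-- Subterm of a term at a position. -/
def Tm.atPos : List ℕ → Tm → Option Tm
  | [], t => some t
  | _ :: _, .var _ => none
  | i :: p, .fn _ ts => (ts[i]?).bind (Tm.atPos p)

/-- Replace the subterm at a position in a term. -/
def Tm.replaceAt : List ℕ → Tm → Tm → Option Tm
  | [], _, u => some u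
  | _ :: _, .var _, _ => none
  | i :: p, .fn f ts, u =>
    (ts[i]?).bind fun t => (Tm.replaceAt p t u).map fun t' => Tm.fn f (ts.set i t')

/-- Subterm of an atom at a position: the head of the position selects an
argument, the tail a position inside that argument. A position of length 1
is a top position. -/
def Atom.atPos (A : Atom) : List ℕ → Option Tm
  | [] => none
  | i :: p => (A.args[i]?).bind (Tm.atPos p)

def Atom.replaceAt (A : Atom) : List ℕ → Tm → Option Atom
  | [], _ => none
  | i :: p, u =>
    (A.args[i]?).bind fun t =>
      (Tm.replaceAt p t u).map fun t' => ⟨A.pred, A.args.set i t'⟩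

/-- A complex term is a non-variable term. -/
def Tm.Complex : Tm → Prop
  | .var _ => False
  | .fn _ _ => True

mutual
/-- Skeleton computation with a fresh-variable counter. -/
def Tm.sktAux : Tm → ℕ → Tm × ℕ
  | .var _, n => (.var n, n + 1)
  | .fn f ts, n =>
    let r := Tm.sktAuxList ts n
    (.fn f r.1, r.2)
def Tm.sktAuxList : List Tm → ℕ → List Tm × ℕ
  | [], n => ([], n)
  | t :: ts, n =>
    let r := Tm.sktAux t n
    let r' := Tm.sktAuxList ts r.2
    (r.1 :: r'.1, r'.2)
end

/-- The term skeleton: every variable occurrence is replaced by a distinct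
fresh variable. -/
def Tm.skeleton (t : Tm) : Tm := (Tm.sktAux t 0).1

/-- The projection μ_P on atoms: replaces P(t₁,…,tₙ) by T(f_P(t₁,…,tₙ)). -/
def projAtom (P T f : ℕ) (A : Atom) : Atom :=
  if A.pred = P then ⟨T, [Tm.fn f A.args]⟩ else A

def projClause (P T f : ℕ) (C : Clause) : Clause :=
  ⟨C.neg.map (projAtom P T f), C.pos.map (projAtom P T f)⟩

def projSet (P T f : ℕ) (N : Set Clause) : Set Clause := projClause P T f '' N

/-- The reverse projection μ_P⁻¹ on Herbrand interpretations. -/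
def projInvInterp (P T f : ℕ) (I : Set Atom) : Set Atom := projAtom P T f ⁻¹' I

/-- The reverse projection μ_P⁻¹ on atoms: T(f_P(t₁,…,tₙ)) is mapped back
to P(t₁,…,tₙ), all other atoms are unchanged. -/
def unprojAtom (P T f : ℕ) (A : Atom) : Atom :=
  match A with
  | ⟨Q, [Tm.fn g ts]⟩ => if Q = T ∧ g = f then ⟨P, ts⟩ else ⟨Q, [Tm.fn g ts]⟩
  | A => A

def unprojClause (P T f : ℕ) (C : Clause) : Clause :=
  ⟨C.neg.map (unprojAtom P T f), C.pos.map (unprojAtom P T f)⟩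

/-- The substitution {x ↦ x'}. -/
def singleSubst (x x' : ℕ) : Subst := fun y => if y = x then Tm.var x' else Tm.var y

/-- Monadic transformation step (T is the fixed projection predicate,
`fp P` the projection function symbol for the predicate `P`). -/
def MOStep (T : ℕ) (fp : ℕ → ℕ) (N N' : Set Clause) : Prop :=
  ∃ (P : ℕ) (C C' : Clause) (A : Atom) (M : Multiset Atom),
    C ∈ N ∧ A.pred = P ∧ P ≠ T ∧ 2 ≤ A.args.length ∧
    ((C.neg = A ::ₘ M ∧ C'.neg = (projAtom P T (fp P) A) ::ₘ M ∧ C'.pos = C.pos) ∨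
     (C.pos = A ::ₘ M ∧ C'.pos = (projAtom P T (fp P) A) ::ₘ M ∧ C'.neg = C.neg)) ∧
    N' = (N \ {C}) ∪ {C'}

/-- Horn transformation step: replace Γ → E₁,…,Eₙ (n > 1) by Γ → Eᵢ. -/
def HOStep (N N' : Set Clause) : Prop :=
  ∃ (C : Clause) (E : Atom),
    C ∈ N ∧ E ∈ C.pos ∧ 2 ≤ Multiset.card C.pos ∧
    N' = (N \ {C}) ∪ {⟨C.neg, {E}⟩}

/-- Shallow transformation step: replace Γ₁,Γ₂ → E[s]_p (s complex, p not a
top position) by S(x), Γ₁ → E[x]_p and Γ₂ → S(s), with S, x fresh. -/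
def SHStep (N N' : Set Clause) : Prop :=
  ∃ (Γ₁ Γ₂ : Multiset Atom) (E E' : Atom) (p : List ℕ) (s : Tm) (S x : ℕ),
    (⟨Γ₁ + Γ₂, {E}⟩ : Clause) ∈ N ∧
    E.atPos p = some s ∧ Tm.Complex s ∧ 2 ≤ p.length ∧
    PredNotIn S N ∧ VarNotInClause x ⟨Γ₁ + Γ₂, {E}⟩ ∧
    E.replaceAt p (Tm.var x) = some E' ∧
    N' = (N \ {(⟨Γ₁ + Γ₂, {E}⟩ : Clause)}) ∪
      {(⟨(⟨S, [Tm.var x]⟩ : Atom) ::ₘ Γ₁, {E'}⟩ : Clause),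
       (⟨Γ₂, {(⟨S, [s]⟩ : Atom)}⟩ : Clause)}

/-- Linear transformation step: replace Γ → E[x]_{p,q} by
Γ{x ↦ x'}, Γ → E[x']_q with x' fresh. -/
def LIStep (N N' : Set Clause) : Prop :=
  ∃ (Γ : Multiset Atom) (E E' : Atom) (p q : List ℕ) (x x' : ℕ),
    (⟨Γ, {E}⟩ : Clause) ∈ N ∧ p ≠ q ∧
    E.atPos p = some (Tm.var x) ∧ E.atPos q = some (Tm.var x) ∧
    VarNotInClause x' ⟨Γ, {E}⟩ ∧
    E.replaceAt q (Tm.var x') = some E' ∧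
    N' = (N \ {(⟨Γ, {E}⟩ : Clause)}) ∪
      {(⟨Γ.map (Atom.subst (singleSubst x x')) + Γ, {E'}⟩ : Clause)}

/-- Applicability of the Monadic transformation: a non-monadic atom occurs. -/
def MOApp (N : Set Clause) : Prop := ∃ C ∈ N, ∃ A, AtomIn A C ∧ 2 ≤ A.args.length

/-- Applicability of the Horn transformation: a non-Horn clause occurs. -/
def HOApp (N : Set Clause) : Prop := ∃ C ∈ N, 2 ≤ Multiset.card C.pos

/-- Applicability of the Shallow transformation. -/
def SHApp (N : Set Clause) : Prop :=
  ∃ C ∈ N, ∃ E ∈ C.pos, ∃ (p : List ℕ) (s : Tm),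
    E.atPos p = some s ∧ Tm.Complex s ∧ 2 ≤ p.length

/-- Applicability of the Linear transformation. -/
def LIApp (N : Set Clause) : Prop :=
  ∃ C ∈ N, ∃ E ∈ C.pos, ∃ (p q : List ℕ) (x : ℕ),
    p ≠ q ∧ E.atPos p = some (Tm.var x) ∧ E.atPos q = some (Tm.var x)

/-- The approximation relation ⇒_apr: the union of the four transformations,
Monadic preceding Horn preceding Shallow preceding Linear. -/
def Apr (T : ℕ) (fp : ℕ → ℕ) (N N' : Set Clause) : Prop :=
  MOStep T fp N N' ∨
  (¬ MOApp N ∧ HOStep N N') ∨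
  (¬ MOApp N ∧ ¬ HOApp N ∧ SHStep N N') ∨
  (¬ MOApp N ∧ ¬ HOApp N ∧ ¬ SHApp N ∧ LIStep N N')

/-- Reflexive-transitive closure of ⇒_apr. -/
def AprStar (T : ℕ) (fp : ℕ → ℕ) : Set Clause → Set Clause → Prop :=
  Relation.ReflTransGen (Apr T fp)

/-- Freshness of the projection symbols for a clause set: `fp` is injective,
`T` and the symbols `fp P` do not occur in `N`. -/
def FreshFor (T : ℕ) (fp : ℕ → ℕ) (N : Set Clause) : Prop :=
  Function.Injective fp ∧ PredNotIn T N ∧ ∀ P, FnNotIn (fp P) N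

/-- Minimal Herbrand model with respect to set inclusion. -/
def MinimalModel (I : Set Atom) (N : Set Clause) : Prop :=
  Models I N ∧ ∀ J : Set Atom, J ⊂ I → ¬ Models J N

/-- A clause set is monadic if all predicates have at most one argument. -/
def MonadicSet (N : Set Clause) : Prop :=
  ∀ C ∈ N, ∀ A, AtomIn A C → A.args.length ≤ 1

end FOApprox
namespace FOApprox

/-- Entailment of a clause implication: every Herbrand model of `M`
satisfying `C₁` also satisfies `C₂`. -/
def EntailsClauseImp (M : Set Clause) (C₁ C₂ : Clause) : Prop :=
  ∀ I : Set Atom, Models I M → SatClause I C₁ → SatClause I C₂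

/-- The set of unit clauses expressing the negation of a clause. -/
def NegClauses (C : Clause) : Set Clause :=
  {D | ∃ A ∈ C.neg, D = ⟨0, {A}⟩} ∪ {D | ∃ A ∈ C.pos, D = ⟨{A}, 0⟩}

/-- A substitution is a (variable) renaming. -/
def IsRenaming (σ : Subst) : Prop :=
  (∀ x, ∃ y, σ x = Tm.var y) ∧ Function.Injective σ

/-- The clauses of `N` are pairwise variable disjoint. -/
def PairwiseVarDisjoint (N : Set Clause) : Prop :=
  ∀ C ∈ N, ∀ D ∈ N, C ≠ D → ∀ x, VarInClause x C → ¬ VarInClause x D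

/-- `R` is a resolvent on an `S`-literal of two clauses from `Nb`. -/
def SResolvent (S : ℕ) (Nb : Set Clause) (R : Clause) : Prop :=
  ∃ D₁ ∈ Nb, ∃ D₂ ∈ Nb, ∃ (A : Atom) (M₁ M₂ : Multiset Atom),
    A.pred = S ∧ D₁.neg = A ::ₘ M₁ ∧ D₂.pos = A ::ₘ M₂ ∧
    R = ⟨M₁ + D₂.neg, D₁.pos + M₂⟩

/-- The set of ground instances of clauses of `N`. -/
def GroundInstances (N : Set Clause) : Set Clause :=
  {D | (∃ C ∈ N, ∃ σ : Subst, D = Clause.subst σ C) ∧ D.Ground}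

/-- `A` is the strictly maximal atom of `D`, occurring positively. -/
def StrictlyMaxIn (altlt : Atom → Atom → Prop) (A : Atom) (D : Clause) : Prop :=
  ∃ M, D.pos = A ::ₘ M ∧ ∀ B ∈ D.neg + M, altlt B A

/-- The productive atoms δ_D of a ground clause, defined by well-founded
recursion along the ground clause ordering. -/
noncomputable def delta (Ng : Set Clause) (altlt : Atom → Atom → Prop)
    {clt : Clause → Clause → Prop} (wf : WellFounded clt) : Clause → Set Atom :=
  WellFounded.fix (C := fun _ => Set Atom) wf fun D IH =>
    {A | D ∈ Ng ∧ StrictlyMaxIn altlt A D ∧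
      ¬ SatClause (⋃ D', ⋃ (h : clt D' D), IH D' h) D}

/-- The superposition partial minimal model operator I_N. -/
noncomputable def partialModel (N : Set Clause) (altlt : Atom → Atom → Prop)
    {clt : Clause → Clause → Prop} (wf : WellFounded clt) : Set Atom :=
  ⋃ C ∈ GroundInstances N, delta (GroundInstances N) altlt wf C

/-- The hypothesis of the direct Horn lifting lemma for the Horn step
replacing `C₀` (the non-Horn ancestor) by `C₁`, with conflicting core `Nb`. -/
def DirectHornHyp (Nk : Set Clause) (C₀ C₁ : Clause) (Nb : Set Clause) : Prop :=
  ∃ (m : ℕ) (σ σ' τ : Fin m → Subst) (Nsub : Fin m → Set Clause),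
    (∀ j, Clause.subst (σ j) C₁ ∈ Nb) ∧
    (∀ D ∈ Nb, (∃ ρ : Subst, D = Clause.subst ρ C₁) →
      ∃ j, D = Clause.subst (σ j) C₁) ∧
    (∀ j, Nsub j ⊆ Nk) ∧
    (∀ j, EntailsClauseImp (SubstSet (τ j) (Nsub j))
      (Clause.subst (σ' j) C₀) (Clause.subst (σ j) C₁)) ∧
    (∀ j, ConflictingCore (SubstSet (τ j) (Nsub j) ∪
      {Clause.subst (σ' j) C₀} ∪ NegClauses (Clause.subst (σ j) C₁)))

end FOApprox

namespace FOApprox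

section TermReplacement

theorem Tm.coe_varsList (ts : List Tm) :
    (Tm.varsList ts : Multiset ℕ) = (ts.map fun t => (t.vars : Multiset ℕ)).sum := by
  induction ts with
  | nil => simp [Tm.varsList]
  | cons t ts ih => simp [Tm.varsList, ← ih, ← Multiset.coe_add]

theorem sum_map_set_add {α M : Type*} [AddCommMonoid M] (g : α → M) (b : α) :
    ∀ (l : List α) (i : ℕ) (a : α), l[i]? = some a →
      ((l.set i b).map g).sum + g a = (l.map g).sum + g b
  | [], _, _, h => by simp at h
  | c :: l, 0, a, h => by
    obtain rfl : c = a := by simpa using h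
    simp only [List.set_cons_zero, List.map_cons, List.sum_cons]
    abel
  | c :: l, i + 1, a, h => by
    have ih := sum_map_set_add g b l i a (by simpa using h)
    simp only [List.set_cons_succ, List.map_cons, List.sum_cons, add_assoc, ih]

/-- Replacing a subterm exchanges its contribution to any additive symbol count. -/
theorem Tm.replaceAt_add {M : Type*} [AddCancelCommMonoid M] (g : Tm → M) (h : ℕ → M)
    (hg : ∀ f ts, g (.fn f ts) = h f + (ts.map g).sum) {u : Tm} :
    ∀ {p : List ℕ} {t s t' : Tm}, t.replaceAt p u = some t' → t.atPos p = some s →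
      g t' + g s = g t + g u := by
  intro p
  induction p with
  | nil =>
    intro t s t' hr ha
    simp only [Tm.replaceAt, Tm.atPos, Option.some.injEq] at hr ha
    subst hr ha
    exact add_comm _ _
  | cons i p ih =>
    intro t s t' hr ha
    cases t with
    | var x => simp [Tm.atPos] at ha
    | fn f ts =>
      simp only [Tm.replaceAt, Tm.atPos, Option.bind_eq_some_iff, Option.map_eq_some_iff] at hr ha
      obtain ⟨t, ht, r, hr, rfl⟩ := hr
      obtain ⟨t₂, ht₂, ha⟩ := ha
      obtain rfl : t = t₂ := by simpa [ht] using ht₂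
      have h₁ := ih hr ha
      have h₂ := sum_map_set_add g r ts i t ht
      rw [hg, hg]
      apply add_right_cancel (b := g t + g r)
      calc h f + ((ts.set i r).map g).sum + g s + (g t + g r)
          = h f + (((ts.set i r).map g).sum + g t) + (g r + g s) := by abel
        _ = h f + ((ts.map g).sum + g r) + (g t + g u) := by rw [h₁, h₂]
        _ = h f + (ts.map g).sum + g u + (g t + g r) := by abel

theorem Tm.le_of_atPos {M : Type*} [AddCommMonoid M] [PartialOrder M] [CanonicallyOrderedAdd M]
    (g : Tm → M) (h : ℕ → M) (hg : ∀ f ts, g (.fn f ts) = h f + (ts.map g).sum) :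
    ∀ {p : List ℕ} {t s : Tm}, t.atPos p = some s → g s ≤ g t := by
  intro p
  induction p with
  | nil => rintro t s ha; simp_all [Tm.atPos]
  | cons i p ih =>
    intro t s ha
    cases t with
    | var x => simp [Tm.atPos] at ha
    | fn f ts =>
      obtain ⟨t, ht, ha⟩ := by simpa only [Tm.atPos, Option.bind_eq_some_iff] using ha
      rw [hg]
      exact (ih ha).trans
        ((List.le_sum_of_mem (List.mem_map_of_mem (List.mem_of_getElem? ht))).trans le_add_self)

theorem Tm.atPos_replaceAt_of_ne {u : Tm} {x y : ℕ} :
    ∀ {p q : List ℕ} {t t' : Tm}, p ≠ q → t.atPos p = some (.var x) →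
      t.atPos q = some (.var y) → t.replaceAt q u = some t' → t'.atPos p = some (.var x) := by
  intro p
  induction p with
  | nil =>
    intro q t t' hne hp hq
    cases q <;> simp_all [Tm.atPos]
  | cons i p ih =>
    intro q t t' hne hp hq hr
    cases t with
    | var z => simp [Tm.atPos] at hp
    | fn f ts =>
      cases q with
      | nil => simp [Tm.atPos] at hq
      | cons j q =>
        simp only [Tm.replaceAt, Tm.atPos, Option.bind_eq_some_iff, Option.map_eq_some_iff]
          at hp hq hr
        obtain ⟨s, hs, r, hr, rfl⟩ := hr
        obtain ⟨s₁, hs₁, hp⟩ := hp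
        obtain ⟨s₂, hs₂, hq⟩ := hq
        simp only [Tm.atPos, Option.bind_eq_some_iff]
        obtain rfl : s = s₂ := by simpa [hs] using hs₂
        by_cases hij : j = i
        · subst hij
          obtain rfl : s = s₁ := by simpa [hs] using hs₁
          have hlt := (List.getElem?_eq_some_iff.mp hs).1
          exact ⟨r, by simp [hlt], ih (by simpa using hne) hp hq hr⟩
        · exact ⟨s₁, by rw [List.getElem?_set_ne hij, hs₁], hp⟩

end TermReplacement

section AtomMeasures

/-- The term with the same arguments as an atom. -/
def Atom.toTm (A : Atom) : Tm := .fn A.pred A.args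

theorem Atom.toTm_atPos {A : Atom} {p : List ℕ} {s : Tm} (h : A.atPos p = some s) :
    A.toTm.atPos p = some s := by
  cases p with
  | nil => simp [Atom.atPos] at h
  | cons i p => exact h

theorem Atom.toTm_replaceAt {A A' : Atom} {p : List ℕ} {u : Tm}
    (h : A.replaceAt p u = some A') : A.toTm.replaceAt p u = some A'.toTm := by
  cases p with
  | nil => simp [Atom.replaceAt] at h
  | cons i p =>
    simp only [Atom.replaceAt, Option.bind_eq_some_iff, Option.map_eq_some_iff] at h
    obtain ⟨t, ht, r, hr, rfl⟩ := h
    simp [Atom.toTm, Tm.replaceAt, ht, hr]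

theorem Atom.length_args_replaceAt {A A' : Atom} {p : List ℕ} {u : Tm}
    (h : A.replaceAt p u = some A') : A'.args.length = A.args.length := by
  cases p with
  | nil => simp [Atom.replaceAt] at h
  | cons i p =>
    simp only [Atom.replaceAt, Option.bind_eq_some_iff, Option.map_eq_some_iff] at h
    obtain ⟨t, ht, r, hr, rfl⟩ := h
    simp

/-- The number of function symbol occurrences in a term. -/
def Tm.fnCount (t : Tm) : ℕ := t.fns.length

theorem Tm.fnCount_fn (f : ℕ) (ts : List Tm) :
    Tm.fnCount (.fn f ts) = 1 + (ts.map Tm.fnCount).sum := by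
  have h : (Tm.fnsList ts).length = (ts.map Tm.fnCount).sum := by
    induction ts with
    | nil => rfl
    | cons t ts ih => simp [Tm.fnsList, Tm.fnCount, ih]
  simp [Tm.fnCount, Tm.fns, ← h, add_comm]

theorem Tm.coe_vars_fn (f : ℕ) (ts : List Tm) :
    ((Tm.fn f ts).vars : Multiset ℕ) = 0 + (ts.map fun t => (t.vars : Multiset ℕ)).sum := by
  rw [zero_add, ← Tm.coe_varsList, Tm.vars]

theorem Tm.Complex.fnCount_pos {s : Tm} (h : s.Complex) : 1 ≤ s.fnCount := by
  cases s with
  | var x => exact h.elim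
  | fn f ts => rw [Tm.fnCount_fn]; omega

/-- A weight of atoms that strictly decreases, in sum, when a complex term at a non-top
position is abstracted out. -/
def Atom.depthWeight (A : Atom) : ℕ := (A.toTm.fnCount - 1) ^ 2

theorem Atom.depthWeight_shallow {E E' : Atom} {p : List ℕ} {s : Tm} (S x : ℕ)
    (hs : E.atPos p = some s) (hc : s.Complex) (hp : 2 ≤ p.length)
    (hr : E.replaceAt p (.var x) = some E') :
    E'.depthWeight + Atom.depthWeight ⟨S, [s]⟩ < E.depthWeight := by
  have hadd := Tm.replaceAt_add Tm.fnCount (fun _ => 1) Tm.fnCount_fn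
    (Atom.toTm_replaceAt hr) (Atom.toTm_atPos hs)
  have hle : s.fnCount + 2 ≤ E.toTm.fnCount := by
    match p, hp with
    | i :: j :: p, _ =>
      obtain ⟨t, ht, ha⟩ := by simpa only [Atom.atPos, Option.bind_eq_some_iff] using hs
      have h₁ : t.fnCount ≤ (E.args.map Tm.fnCount).sum :=
        List.le_sum_of_mem (List.mem_map_of_mem (List.mem_of_getElem? ht))
      have h₂ : s.fnCount + 1 ≤ t.fnCount := by
        cases t with
        | var y => simp [Tm.atPos] at ha
        | fn f ts =>
          obtain ⟨t, ht, ha⟩ := by simpa only [Tm.atPos, Option.bind_eq_some_iff] using ha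
          have h₃ := Tm.le_of_atPos Tm.fnCount (fun _ => 1) Tm.fnCount_fn ha
          have h₄ : t.fnCount ≤ (ts.map Tm.fnCount).sum :=
            List.le_sum_of_mem (List.mem_map_of_mem (List.mem_of_getElem? ht))
          rw [Tm.fnCount_fn]
          omega
      rw [Atom.toTm, Tm.fnCount_fn]
      omega
  have hpos := hc.fnCount_pos
  have hvar : (Tm.var x).fnCount = 0 := rfl
  have hS : (Atom.toTm ⟨S, [s]⟩).fnCount = s.fnCount + 1 := by
    simp [Atom.toTm, Tm.fnCount_fn, add_comm]
  obtain ⟨a, ha⟩ : ∃ a, E'.toTm.fnCount = a + 2 := ⟨E'.toTm.fnCount - 2, by omega⟩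
  obtain ⟨b, hb⟩ : ∃ b, s.fnCount = b + 1 := ⟨s.fnCount - 1, by omega⟩
  have hE : E.toTm.fnCount = a + b + 3 := by omega
  simp only [Atom.depthWeight, hS, ha, hb, hE]
  simp only [Nat.add_sub_cancel, show a + 2 - 1 = a + 1 by omega,
    show a + b + 3 - 1 = a + b + 2 by omega]
  nlinarith [Nat.zero_le (a * b)]

theorem Atom.depthWeight_linear {E E' : Atom} {q : List ℕ} {x x' : ℕ}
    (hq : E.atPos q = some (.var x)) (hr : E.replaceAt q (.var x') = some E') :
    E'.depthWeight = E.depthWeight := by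
  have hadd := Tm.replaceAt_add Tm.fnCount (fun _ => 1) Tm.fnCount_fn
    (Atom.toTm_replaceAt hr) (Atom.toTm_atPos hq)
  have hvar (y : ℕ) : (Tm.var y).fnCount = 0 := rfl
  simp only [hvar, add_zero] at hadd
  rw [Atom.depthWeight, Atom.depthWeight, hadd]

/-- The number of variable occurrences in excess of the number of distinct variables. -/
def Atom.excess (A : Atom) : ℕ :=
  Multiset.card (A.toTm.vars : Multiset ℕ) - (A.toTm.vars : Multiset ℕ).toFinset.card

theorem Atom.mem_vars_toTm {A : Atom} {x : ℕ} :
    x ∈ A.toTm.vars ↔ ∃ t ∈ A.args, x ∈ t.vars := by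
  have h : ∀ ts : List Tm, x ∈ Tm.varsList ts ↔ ∃ t ∈ ts, x ∈ t.vars := by
    intro ts
    induction ts with
    | nil => simp [Tm.varsList]
    | cons t ts ih => simp [Tm.varsList, ih]
  exact h A.args

theorem Atom.excess_linear {E E' : Atom} {p q : List ℕ} {x x' : ℕ} (hne : p ≠ q)
    (hp : E.atPos p = some (.var x)) (hq : E.atPos q = some (.var x))
    (hx' : x' ∉ E.toTm.vars) (hr : E.replaceAt q (.var x') = some E') :
    E'.excess < E.excess := by
  have hp' := Atom.toTm_atPos hp
  have hq' := Atom.toTm_atPos hq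
  have hr' := Atom.toTm_replaceAt hr
  have hadd := Tm.replaceAt_add (fun t => (t.vars : Multiset ℕ)) (fun _ => 0) Tm.coe_vars_fn hr' hq'
  have hmem := Tm.le_of_atPos (fun t => (t.vars : Multiset ℕ)) (fun _ => 0) Tm.coe_vars_fn
    (Tm.atPos_replaceAt_of_ne hne hp' hq' hr')
  have hvar (y : ℕ) : ((Tm.var y).vars : Multiset ℕ) = {y} := rfl
  simp only [hvar, Multiset.singleton_le] at hadd hmem
  have hcard := congrArg Multiset.card hadd
  have hset := congrArg Multiset.toFinset hadd
  simp only [Multiset.card_add, Multiset.card_singleton, Nat.add_right_cancel_iff] at hcard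
  have hset : (E'.toTm.vars : Multiset ℕ).toFinset
      = insert x' (E.toTm.vars : Multiset ℕ).toFinset := by
    rw [Multiset.toFinset_add, Multiset.toFinset_add, Multiset.toFinset_singleton,
      Multiset.toFinset_singleton, Finset.union_eq_left.2 (by simpa using hmem)] at hset
    rw [hset, Finset.insert_eq, Finset.union_comm]
  have hcs := congrArg Finset.card hset
  rw [Finset.card_insert_of_notMem (by simpa using hx')] at hcs
  have hle := Multiset.toFinset_card_le (E'.toTm.vars : Multiset ℕ)
  unfold Atom.excess
  omega

end AtomMeasures

section ClauseMeasures

/-- The number of occurrences of non-monadic atoms in a multiset. -/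
def nonMonadicCount (M : Multiset Atom) : ℕ := M.countP fun A => 2 ≤ A.args.length

def Clause.nonMonadic (C : Clause) : ℕ := nonMonadicCount C.neg + nonMonadicCount C.pos

def Clause.nonHorn (C : Clause) : ℕ := Multiset.card C.pos - 1

def Clause.depthWeight (C : Clause) : ℕ := (C.pos.map Atom.depthWeight).sum

def Clause.excess (C : Clause) : ℕ := (C.pos.map Atom.excess).sum

theorem Clause.nonMonadic_eq_zero {N : Set Clause} (h : ¬ MOApp N) {C : Clause} (hC : C ∈ N) :
    C.nonMonadic = 0 := by
  simp only [Clause.nonMonadic, nonMonadicCount, Nat.add_eq_zero_iff, Multiset.countP_eq_zero]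
  exact ⟨fun A hA hl => h ⟨C, hC, A, .inl hA, hl⟩, fun A hA hl => h ⟨C, hC, A, .inr hA, hl⟩⟩

/-- The sum of a clause measure over a finite clause set. -/
noncomputable def total (m : Clause → ℕ) (N : Set Clause) : ℕ := ∑ᶠ C ∈ N, m C

theorem total_replace_add_le (m : Clause → ℕ) {N : Set Clause} (hN : N.Finite) {C : Clause}
    (hC : C ∈ N) (D : Finset Clause) :
    total m ((N \ {C}) ∪ D) + m C ≤ total m N + ∑ C' ∈ D, m C' := by
  classical
  lift N to Finset Clause using hN
  have hset : ((N : Set Clause) \ {C}) ∪ D = ((N.erase C ∪ D : Finset Clause) : Set Clause) := by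
    simp
  rw [hset, total, total, finsum_mem_coe_finset, finsum_mem_coe_finset]
  have h₁ := Finset.sum_erase_add N m (Finset.mem_coe.1 hC)
  have h₂ : ∑ C' ∈ N.erase C ∪ D, m C' ≤ ∑ C' ∈ N.erase C, m C' + ∑ C' ∈ D, m C' := by
    rw [← Finset.sum_union_inter]
    exact Nat.le_add_right _ _
  omega

theorem total_replace_one (m : Clause → ℕ) {N : Set Clause} (hN : N.Finite) {C : Clause}
    (hC : C ∈ N) (C' : Clause) :
    total m ((N \ {C}) ∪ {C'}) + m C ≤ total m N + m C' := by
  simpa using total_replace_add_le m hN hC {C'}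

theorem total_replace_two (m : Clause → ℕ) {N : Set Clause} (hN : N.Finite) {C : Clause}
    (hC : C ∈ N) (C₁ C₂ : Clause) :
    total m ((N \ {C}) ∪ {C₁, C₂}) + m C ≤ total m N + (m C₁ + m C₂) := by
  classical
  have h := total_replace_add_le m hN hC {C₁, C₂}
  have h' : ∑ C' ∈ ({C₁, C₂} : Finset Clause), m C' ≤ m C₁ + m C₂ := by
    by_cases he : C₁ = C₂
    · subst he; simp
    · rw [Finset.sum_pair he]
  rw [Finset.coe_pair] at h
  omega

end ClauseMeasures

section Steps

variable {T : ℕ} {fp : ℕ → ℕ} {N N' : Set Clause}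

theorem MOStep.total_lt (hN : N.Finite) (h : MOStep T fp N N') :
    total Clause.nonMonadic N' < total Clause.nonMonadic N := by
  obtain ⟨P, C, C', A, M, hC, hP, -, hA, hrepl, rfl⟩ := h
  have ht := total_replace_one Clause.nonMonadic hN hC C'
  have hlt : C'.nonMonadic < C.nonMonadic := by
    rcases hrepl with ⟨h₁, h₂, h₃⟩ | ⟨h₁, h₂, h₃⟩ <;>
      simp [Clause.nonMonadic, nonMonadicCount, h₁, h₂, h₃, projAtom, hP, hA]
  omega

theorem HOStep.total_le_and_lt (hN : N.Finite) (h : HOStep N N') :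
    total Clause.nonMonadic N' ≤ total Clause.nonMonadic N ∧
      total Clause.nonHorn N' < total Clause.nonHorn N := by
  obtain ⟨C, E, hC, hE, hcard, rfl⟩ := h
  have h₁ := total_replace_one Clause.nonMonadic hN hC ⟨C.neg, {E}⟩
  have h₂ := total_replace_one Clause.nonHorn hN hC ⟨C.neg, {E}⟩
  have hm : nonMonadicCount {E} ≤ nonMonadicCount C.pos :=
    Multiset.countP_le_of_le _ (Multiset.singleton_le.2 hE)
  simp only [Clause.nonMonadic, Clause.nonHorn, Multiset.card_singleton] at h₁ h₂
  omega

theorem SHStep.total_le_and_lt (hN : N.Finite) (h : SHStep N N') :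
    total Clause.nonMonadic N' ≤ total Clause.nonMonadic N ∧
      total Clause.nonHorn N' ≤ total Clause.nonHorn N ∧
      total Clause.depthWeight N' < total Clause.depthWeight N := by
  obtain ⟨Γ₁, Γ₂, E, E', p, s, S, x, hC, hs, hc, hp, -, -, hr, rfl⟩ := h
  have h (m : Clause → ℕ) := total_replace_two m hN hC
    ⟨(⟨S, [Tm.var x]⟩ : Atom) ::ₘ Γ₁, {E'}⟩ ⟨Γ₂, {(⟨S, [s]⟩ : Atom)}⟩
  have h₁ := h Clause.nonMonadic
  have h₂ := h Clause.nonHorn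
  have h₃ := h Clause.depthWeight
  have hw := Atom.depthWeight_shallow S x hs hc hp hr
  have hm : Clause.nonMonadic ⟨(⟨S, [Tm.var x]⟩ : Atom) ::ₘ Γ₁, {E'}⟩
      + Clause.nonMonadic ⟨Γ₂, {(⟨S, [s]⟩ : Atom)}⟩ = Clause.nonMonadic ⟨Γ₁ + Γ₂, {E}⟩ := by
    simp only [Clause.nonMonadic, nonMonadicCount, Multiset.countP_add, Multiset.countP_cons,
      ← Multiset.cons_zero, Multiset.countP_zero, Atom.length_args_replaceAt hr]
    simp
    omega
  have hd (Γ : Multiset Atom) (A : Atom) : Clause.depthWeight ⟨Γ, {A}⟩ = A.depthWeight := by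
    simp [Clause.depthWeight]
  have hh (Γ : Multiset Atom) (A : Atom) : Clause.nonHorn ⟨Γ, {A}⟩ = 0 := by
    simp [Clause.nonHorn]
  simp only [hd, hh] at h₂ h₃
  exact ⟨by omega, by omega, by omega⟩

theorem LIStep.total_le_and_lt (hN : N.Finite) (hmo : ¬ MOApp N) (h : LIStep N N') :
    total Clause.nonMonadic N' ≤ total Clause.nonMonadic N ∧
      total Clause.nonHorn N' ≤ total Clause.nonHorn N ∧
      total Clause.depthWeight N' ≤ total Clause.depthWeight N ∧
      total Clause.excess N' < total Clause.excess N := by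
  obtain ⟨Γ, E, E', p, q, x, x', hC, hne, hp, hq, hx', hr, rfl⟩ := h
  have h (m : Clause → ℕ) := total_replace_one m hN hC
    ⟨Γ.map (Atom.subst (singleSubst x x')) + Γ, {E'}⟩
  have h₁ := h Clause.nonMonadic
  have h₂ := h Clause.nonHorn
  have h₃ := h Clause.depthWeight
  have h₄ := h Clause.excess
  have hw := Atom.depthWeight_linear hq hr
  have hnot : x' ∉ E.toTm.vars := fun hmem =>
    hx' ⟨E, .inr (Multiset.mem_singleton_self E), Atom.mem_vars_toTm.1 hmem⟩
  have he := Atom.excess_linear hne hp hq hnot hr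
  have hlen (σ : Subst) : ∀ ts : List Tm, (Tm.substList σ ts).length = ts.length := by
    intro ts
    induction ts with
    | nil => rfl
    | cons t ts ih => simp [Tm.substList, ih]
  have hz := Clause.nonMonadic_eq_zero hmo hC
  have hm : Clause.nonMonadic ⟨Γ.map (Atom.subst (singleSubst x x')) + Γ, {E'}⟩ = 0 := by
    simp only [Clause.nonMonadic, nonMonadicCount, Multiset.countP_add, ← Multiset.cons_zero,
      Multiset.countP_cons, Multiset.countP_zero, Multiset.countP_map,
      ← Multiset.countP_eq_card_filter, Atom.length_args_replaceAt hr, Atom.subst, hlen] at hz ⊢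
    omega
  have hd (Γ : Multiset Atom) (A : Atom) : Clause.depthWeight ⟨Γ, {A}⟩ = A.depthWeight := by
    simp [Clause.depthWeight]
  have hh (Γ : Multiset Atom) (A : Atom) : Clause.nonHorn ⟨Γ, {A}⟩ = 0 := by
    simp [Clause.nonHorn]
  have hv (Γ : Multiset Atom) (A : Atom) : Clause.excess ⟨Γ, {A}⟩ = A.excess := by
    simp [Clause.excess]
  simp only [hd, hh, hv] at h₂ h₃ h₄
  exact ⟨by omega, by omega, by omega, by omega⟩

/-- The lexicographic termination measure of the approximation relation. -/
noncomputable def aprMeasure (N : Set Clause) : ℕ ×ₗ ℕ ×ₗ ℕ ×ₗ ℕ :=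
  toLex (total Clause.nonMonadic N, toLex (total Clause.nonHorn N,
    toLex (total Clause.depthWeight N, total Clause.excess N)))

theorem Apr.aprMeasure_lt (hN : N.Finite) (h : Apr T fp N N') :
    aprMeasure N' < aprMeasure N := by
  simp only [aprMeasure, Prod.Lex.toLex_lt_toLex]
  rcases h with h | ⟨-, h⟩ | ⟨-, -, h⟩ | ⟨hmo, -, -, h⟩
  · exact .inl (h.total_lt hN)
  · have := h.total_le_and_lt hN
    omega
  · have := h.total_le_and_lt hN
    omega
  · have := h.total_le_and_lt hN hmo
    omega

end Steps

/-- The approximation relation ⇒_apr terminates: there is no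
infinite sequence of (finite) clause sets N₀ ⇒_apr N₁ ⇒_apr N₂ ⇒_apr ⋯. -/
theorem apr_terminates (T : ℕ) (fp : ℕ → ℕ) :
    ¬ ∃ Ns : ℕ → Set Clause,
      (∀ n, (Ns n).Finite) ∧ ∀ n, Apr T fp (Ns n) (Ns (n + 1)) := by
  rintro ⟨Ns, hfin, hstep⟩
  exact not_strictAnti_of_wellFoundedLT (fun n => aprMeasure (Ns n))
    (strictAnti_nat_of_succ_lt fun n => (hstep n).aprMeasure_lt (hfin n))

end FOApprox
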